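/- Let q ∈ Q and let c, c', c'' ∈ Z^2 be cells satisfying: (1) dist(c, c') ≥ N and dist(c'', c') ≥ N; (2) there is an integer b such that c'' − c = b·(w, z), where (w, z) is the travel vector of the trajectory started from state q (this travel vector does not depend on the starting cell); (3) the trajectory started from (q, c) visits c' at some finite time; (4) the trajectory started from (q, c'') visits c' at some finite time. Let q' be the state of the agent at the first time the trajectory started from (q, c) visits c', and let q'' be the state of the agent at the first time the trajectory started from (q, c'') visits c'. Then q' = q''. -/

import Mathlib

/-- The allowed movements: stay, or move to one of the four neighboring cells. -/
def Moves : Set (ℤ × ℤ) := {(0, 0), (1, 0), (-1, 0), (0, 1), (0, -1)}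

/-- A single-agent deterministic finite automaton on the infinite grid `ℤ × ℤ`:
`δ q` gives the new state and the movement of an agent in state `q`. -/
structure SoloAutomaton (Q : Type) [Fintype Q] where
  δ : Q → Q × (ℤ × ℤ)
  move_mem : ∀ q, (δ q).2 ∈ Moves

variable {Q : Type} [Fintype Q]

/-- The trajectory of the agent started from state-position pair `p`. -/
def traj (A : SoloAutomaton Q) (p : Q × (ℤ × ℤ)) : ℕ → Q × (ℤ × ℤ)
  | 0 => p
  | n + 1 => ((A.δ (traj A p n).1).1, (traj A p n).2 + (A.δ (traj A p n).1).2)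

/-- Manhattan distance on the grid. -/
def mdist (a b : ℤ × ℤ) : ℤ := |a.1 - b.1| + |a.2 - b.2|

/-- `v` is the travel vector of the trajectory started from state `q` (the travel vector
does not depend on the starting cell, so the starting cell is taken to be the origin):
the agent assumes the same state at two times `t < t'` with `t'` minimal, and `v` is the
difference of its positions at those times. -/
def IsTravelVec (A : SoloAutomaton Q) (q : Q) (v : ℤ × ℤ) : Prop :=
  ∃ t t', t < t' ∧ (traj A (q, (0, 0)) t').1 = (traj A (q, (0, 0)) t).1 ∧
    (∀ s s', s < s' → s' < t' → (traj A (q, (0, 0)) s').1 ≠ (traj A (q, (0, 0)) s).1) ∧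
    v = (traj A (q, (0, 0)) t').2 - (traj A (q, (0, 0)) t).2

theorem traj_shift (A : SoloAutomaton Q) (q : Q) (c : ℤ × ℤ) (n : ℕ) :
    (traj A (q, c) n).1 = (traj A (q, (0, 0)) n).1 ∧
    (traj A (q, c) n).2 = c + (traj A (q, (0, 0)) n).2 := by
  induction n with
  | zero => simp [traj]
  | succ n ih =>
    obtain ⟨h1, h2⟩ := ih
    simp only [traj]
    rw [h1, h2]
    exact ⟨rfl, add_assoc _ _ _⟩

theorem traj_norm (A : SoloAutomaton Q) (q : Q) (n : ℕ) :
    |(traj A (q, (0, 0)) n).2.1| + |(traj A (q, (0, 0)) n).2.2| ≤ n := by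
  induction n with
  | zero => simp [traj]
  | succ n ih =>
    have h := A.move_mem (traj A (q, (0, 0)) n).1
    simp only [traj, Prod.fst_add, Prod.snd_add]
    have hm : |(A.δ (traj A (q, (0, 0)) n).1).2.1| + |(A.δ (traj A (q, (0, 0)) n).1).2.2| ≤ 1 := by
      simp only [Moves, Set.mem_insert_iff, Set.mem_singleton_iff] at h
      rcases h with h | h | h | h | h <;> rw [h] <;> simp
    have h1 := abs_add_le (traj A (q, (0, 0)) n).2.1 (A.δ (traj A (q, (0, 0)) n).1).2.1
    have h2 := abs_add_le (traj A (q, (0, 0)) n).2.2 (A.δ (traj A (q, (0, 0)) n).1).2.2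
    push_cast
    linarith

theorem traj_period (A : SoloAutomaton Q) (q : Q) (t p : ℕ) (v : ℤ × ℤ)
    (hs : (traj A (q, (0, 0)) (t + p)).1 = (traj A (q, (0, 0)) t).1)
    (hv : (traj A (q, (0, 0)) (t + p)).2 = (traj A (q, (0, 0)) t).2 + v) (m : ℕ) (hm : t ≤ m) :
    (traj A (q, (0, 0)) (m + p)).1 = (traj A (q, (0, 0)) m).1 ∧
    (traj A (q, (0, 0)) (m + p)).2 = (traj A (q, (0, 0)) m).2 + v := by
  induction m, hm using Nat.le_induction with
  | base => exact ⟨hs, hv⟩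
  | succ m hm ih =>
    obtain ⟨h1, h2⟩ := ih
    rw [show m + 1 + p = (m + p) + 1 by ring]
    simp only [traj]
    rw [h1, h2]
    exact ⟨rfl, add_right_comm _ _ _⟩

theorem traj_periods (A : SoloAutomaton Q) (q : Q) (t p : ℕ) (w z : ℤ)
    (hs : (traj A (q, (0, 0)) (t + p)).1 = (traj A (q, (0, 0)) t).1)
    (hv : (traj A (q, (0, 0)) (t + p)).2 = (traj A (q, (0, 0)) t).2 + (w, z))
    (m : ℕ) (hm : t ≤ m) (k : ℕ) :
    (traj A (q, (0, 0)) (m + k * p)).1 = (traj A (q, (0, 0)) m).1 ∧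
    (traj A (q, (0, 0)) (m + k * p)).2.1 = (traj A (q, (0, 0)) m).2.1 + k * w ∧
    (traj A (q, (0, 0)) (m + k * p)).2.2 = (traj A (q, (0, 0)) m).2.2 + k * z := by
  induction k with
  | zero => simp
  | succ k ih =>
    obtain ⟨h1, h2, h3⟩ := ih
    obtain ⟨g1, g2⟩ := traj_period A q t p (w, z) hs hv (m + k * p) (by omega)
    rw [show m + (k + 1) * p = m + k * p + p by ring, g1, g2, h1]
    refine ⟨rfl, ?_, ?_⟩
    · simp only [Prod.fst_add, h2]; push_cast; ring
    · simp only [Prod.snd_add, h3]; push_cast; ring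

/-- A point strictly outside a ball is no weighted mean of points inside it (one coordinate). -/
theorem abs_weighted (x y P v : ℤ) (l m : ℤ) (hl : 0 ≤ l) (hm : 0 ≤ m)
    (h1 : P = y + l * v) (h2 : P = x - m * v) :
    (l + m) * |P| ≤ m * |y| + l * |x| := by
  have e : (l + m) * P = m * y + l * x := by
    have : (l + m) * P = l * P + m * P := by ring
    rw [this]; nth_rewrite 1 [h2]; rw [h1]; ring
  calc (l + m) * |P| = |(l + m) * P| := by rw [abs_mul, abs_of_nonneg (by omega : 0 ≤ l + m)]
    _ = |m * y + l * x| := by rw [e]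
    _ ≤ |m * y| + |l * x| := abs_add_le _ _
    _ = m * |y| + l * |x| := by rw [abs_mul, abs_mul, abs_of_nonneg hl, abs_of_nonneg hm]

theorem one_side (A : SoloAutomaton Q) (q : Q) (t p N : ℕ) (w z b : ℤ) (hp : 0 < p)
    (hN : t + p ≤ N)
    (hs : (traj A (q, (0, 0)) (t + p)).1 = (traj A (q, (0, 0)) t).1)
    (hv : (traj A (q, (0, 0)) (t + p)).2 = (traj A (q, (0, 0)) t).2 + (w, z))
    (n n' : ℕ) (hn : N ≤ n) (hn' : N ≤ n')
    (hP : (N : ℤ) ≤ |(traj A (q, (0, 0)) n').2.1| + |(traj A (q, (0, 0)) n').2.2|)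
    (hx : (traj A (q, (0, 0)) n).2.1 = (traj A (q, (0, 0)) n').2.1 + b * w)
    (hz : (traj A (q, (0, 0)) n).2.2 = (traj A (q, (0, 0)) n').2.2 + b * z)
    (hmin : ∀ m, m < n' → (traj A (q, (0, 0)) m).2 ≠ (traj A (q, (0, 0)) n').2) :
    ∃ r : ℕ, n' ≤ r ∧ (r : ℤ) = n - b * p ∧
      (traj A (q, (0, 0)) r).1 = (traj A (q, (0, 0)) n).1 := by
  have key : ∀ n : ℕ, N ≤ n → ∃ u k : ℕ, t ≤ u ∧ u < N ∧ n = u + k * p := by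
    intro n hn
    refine ⟨t + (n - t) % p, (n - t) / p, by omega, ?_, ?_⟩
    · have := Nat.mod_lt (n - t) hp
      omega
    · have := Nat.mod_add_div' (n - t) p
      omega
  obtain ⟨u, k, hu, huN, e⟩ := key n hn
  obtain ⟨u', l, hu', huN', e'⟩ := key n' hn'
  obtain ⟨a1, a2, a3⟩ := traj_periods A q t p w z hs hv u hu k
  obtain ⟨b1, b2, b3⟩ := traj_periods A q t p w z hs hv u' hu' l
  rw [← e] at a1 a2 a3
  rw [← e'] at b1 b2 b3
  by_cases hkb : b ≤ k
  · obtain ⟨j, hj⟩ := Int.eq_ofNat_of_zero_le (sub_nonneg.mpr hkb)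
    obtain ⟨d1, d2, d3⟩ := traj_periods A q t p w z hs hv u hu j
    refine ⟨u + j * p, ?_, ?_, d1.trans a1.symm⟩
    · by_contra hlt
      refine hmin _ (not_le.mp hlt) (Prod.ext ?_ ?_)
      · rw [d2, ← hj]; linarith
      · rw [d3, ← hj]; linarith
    · rw [e]; push_cast; rw [← hj]; ring
  · exfalso
    push Not at hkb
    have w1 := abs_weighted _ _ _ w l (b - k) (by omega) (by omega) b2
      (show _ = (traj A (q, (0, 0)) u).2.1 - (b - k) * w by linarith)
    have w2 := abs_weighted _ _ _ z l (b - k) (by omega) (by omega) b3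
      (show _ = (traj A (q, (0, 0)) u).2.2 - (b - k) * z by linarith)
    have n1 := traj_norm A q u
    have n2 := traj_norm A q u'
    have n1' : |(traj A (q, (0, 0)) u).2.1| + |(traj A (q, (0, 0)) u).2.2| ≤ (N : ℤ) - 1 := by omega
    have n2' : |(traj A (q, (0, 0)) u').2.1| + |(traj A (q, (0, 0)) u').2.2| ≤ (N : ℤ) - 1 := by
      omega
    have m1 := mul_le_mul_of_nonneg_left n1' (show (0 : ℤ) ≤ l by omega)
    have m2 := mul_le_mul_of_nonneg_left n2' (show (0 : ℤ) ≤ b - k by omega)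
    have m3 := mul_le_mul_of_nonneg_left hP (show (0 : ℤ) ≤ l + (b - k) by omega)
    nlinarith

/-- Let `q` be a state and `c, c', c''` cells with `dist(c, c') ≥ N`,
`dist(c'', c') ≥ N`, such that `c'' − c` is an integer multiple of the travel vector
`(w, z)` of the trajectory started from state `q`, and such that both the trajectory
started from `(q, c)` and the one started from `(q, c'')` visit `c'`. Then the state at
the first visit of `c'` starting from `(q, c)` equals the state at the first visit of
`c'` starting from `(q, c'')`. -/
theorem state_at_arrival_determined (Q : Type) [Fintype Q] (A : SoloAutomaton Q)
    (q : Q) (c c' c'' : ℤ × ℤ) (w z : ℤ)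
    (hvec : IsTravelVec A q (w, z))
    (hd1 : (Fintype.card Q : ℤ) ≤ mdist c c')
    (hd2 : (Fintype.card Q : ℤ) ≤ mdist c'' c')
    (hmul : ∃ b : ℤ, c'' - c = (b * w, b * z))
    (n n' : ℕ)
    (hn : (traj A (q, c) n).2 = c') (hnmin : ∀ m, m < n → (traj A (q, c) m).2 ≠ c')
    (hn' : (traj A (q, c'') n').2 = c')
    (hn'min : ∀ m, m < n' → (traj A (q, c'') m).2 ≠ c') :
    (traj A (q, c) n).1 = (traj A (q, c'') n').1 := by
  obtain ⟨t, t', htt, hs, hdist, hv⟩ := hvec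
  obtain ⟨b, hb⟩ := hmul
  obtain ⟨p, rfl⟩ := Nat.exists_eq_add_of_lt htt
  rw [add_assoc] at hs hdist hv
  have hN : t + (p + 1) ≤ Fintype.card Q := by
    have hinj : Function.Injective
        (fun i : Fin (t + (p + 1)) => (traj A (q, (0, 0)) i.val).1) := by
      intro i j hij
      rcases lt_trichotomy i.val j.val with h | h | h
      · exact absurd hij.symm (hdist _ _ h j.2)
      · exact Fin.ext h
      · exact absurd hij (hdist _ _ h i.2)
    simpa using Fintype.card_le_of_injective _ hinj
  have hv' : (traj A (q, (0, 0)) (t + (p + 1))).2 = (traj A (q, (0, 0)) t).2 + (w, z) := by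
    rw [hv]; abel
  have far : ∀ (c : ℤ × ℤ) (n : ℕ), (traj A (q, c) n).2 = c' →
      (Fintype.card Q : ℤ) ≤ mdist c c' →
      (Fintype.card Q : ℤ) ≤ |(traj A (q, (0, 0)) n).2.1| + |(traj A (q, (0, 0)) n).2.2| := by
    intro c n h hd
    rw [(traj_shift A q c n).2] at h
    rw [← h] at hd
    simpa [mdist] using hd
  have f1 := far c n hn hd1
  have f2 := far c'' n' hn' hd2
  have g1 := traj_norm A q n
  have g2 := traj_norm A q n'
  have hn0 := hn
  have hn0' := hn'
  rw [(traj_shift A q c n).2] at hn0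
  rw [(traj_shift A q c'' n').2] at hn0'
  have hx : c.1 + (traj A (q, (0, 0)) n).2.1 = c''.1 + (traj A (q, (0, 0)) n').2.1 := by
    have := congrArg Prod.fst (hn0.trans hn0'.symm)
    simpa using this
  have hz : c.2 + (traj A (q, (0, 0)) n).2.2 = c''.2 + (traj A (q, (0, 0)) n').2.2 := by
    have := congrArg Prod.snd (hn0.trans hn0'.symm)
    simpa using this
  have hb1 : c''.1 - c.1 = b * w := by simpa using congrArg Prod.fst hb
  have hb2 : c''.2 - c.2 = b * z := by simpa using congrArg Prod.snd hb
  obtain ⟨r, hr1, hr2, hr3⟩ := one_side A q t (p + 1) (Fintype.card Q) w z b (by omega) hN hs hv'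
    n n' (by omega) (by omega) f2 (by linarith) (by linarith) (by
      intro m hm h
      apply hn'min m hm
      rw [(traj_shift A q c'' m).2, h, hn0'])
  obtain ⟨r', hr1', hr2', hr3'⟩ := one_side A q t (p + 1) (Fintype.card Q) w z (-b) (by omega) hN
    hs hv' n' n (by omega) (by omega) f1 (by linarith) (by linarith) (by
      intro m hm h
      apply hnmin m hm
      rw [(traj_shift A q c m).2, h, hn0])
  have hrn : r = n' := by
    rw [neg_mul] at hr2'
    omega
  rw [(traj_shift A q c n).1, (traj_shift A q c'' n').1, ← hr3, hrn]
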